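/- Let m_1,…,m_n be a minimal generating set of a generic monomial ideal I of R. If two distinct minimal generators m_i and m_j (i < j) have the same positive exponent in some variable, then σ_{ij} ∈ 𝔪Z₂. -/

import Mathlib

open MvPolynomial

noncomputable section

/-- The trivariate polynomial ring `K[x,y,z]`, with variables indexed by `Fin 3`. -/
abbrev PR (K : Type*) [Field K] : Type _ := MvPolynomial (Fin 3) K

/-- The monomial of `K[x,y,z]` with exponent vector `a : Fin 3 → ℕ`. -/
noncomputable def monom (K : Type*) [Field K] (a : Fin 3 → ℕ) : PR K :=
  ∏ t, X t ^ a t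

/-- `m 0, …, m (n-1)` (given by their exponent vectors) form a minimal generating set of the
monomial ideal they generate: they are pairwise distinct and no one divides another.
(Divisibility of monomials is pointwise `≤` of exponent vectors, so non-divisibility for all
pairs of distinct indices already implies distinctness.) -/
def MinGen {n : ℕ} (m : Fin n → Fin 3 → ℕ) : Prop :=
  ∀ i j, i ≠ j → ¬ m i ≤ m j

/-- Strict divisibility of monomials, in terms of exponent vectors: `a` divides `b` and `a ≠ b`. -/
def strictDvd (a b : Fin 3 → ℕ) : Prop := a ≤ b ∧ a ≠ b

/-- Strong divisibility of monomials: `a` divides `b / x_t` for every variable `x_t`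
dividing `b`. -/
def strongDvd (a b : Fin 3 → ℕ) : Prop :=
  ∀ t, 0 < b t → a ≤ b - Pi.single t 1

/-- A monomial ideal (given by the exponent vectors of its minimal generators) is generic if
whenever two distinct minimal generators have the same positive exponent in some variable,
a third minimal generator strongly divides their lcm. -/
def GenericI {n : ℕ} (m : Fin n → Fin 3 → ℕ) : Prop :=
  ∀ i j, i ≠ j → (∃ t, 0 < m i t ∧ m i t = m j t) →
    ∃ l, l ≠ i ∧ l ≠ j ∧ strongDvd (m l) (m i ⊔ m j)

/-- The homogeneous maximal ideal `𝔪 = (x,y,z)` of `K[x,y,z]`. -/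
noncomputable def mxIdeal (K : Type*) [Field K] : Ideal (PR K) :=
  Ideal.span (Set.range X)

/-- The `R`-linear map `f₁ : Rⁿ → R` sending the `i`-th standard basis vector to the
monomial `m_i`. -/
noncomputable def syzF1 (K : Type*) [Field K] {n : ℕ} (m : Fin n → Fin 3 → ℕ) :
    (Fin n → PR K) →ₗ[PR K] PR K where
  toFun v := ∑ i, v i * monom K (m i)
  map_add' u v := by simp [add_mul, Finset.sum_add_distrib]
  map_smul' c v := by simp [Finset.mul_sum, mul_assoc]

/-- The module `Z₂ = ker f₁` of second syzygies of `R/I`. -/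
noncomputable def Z2 (K : Type*) [Field K] {n : ℕ} (m : Fin n → Fin 3 → ℕ) :
    Submodule (PR K) (Fin n → PR K) :=
  LinearMap.ker (syzF1 K m)

/-- The S-pair `σ_{ij} = (m_{ij}/m_j)·e_j − (m_{ij}/m_i)·e_i ∈ Rⁿ`. -/
noncomputable def sigmaS (K : Type*) [Field K] {n : ℕ} (m : Fin n → Fin 3 → ℕ)
    (i j : Fin n) : Fin n → PR K :=
  Pi.single j (monom K ((m i ⊔ m j) - m j)) - Pi.single i (monom K ((m i ⊔ m j) - m i))

/-- `τ_{ijl} = (m_{ijl}/m_{ij})·e_{ij} − (m_{ijl}/m_{il})·e_{il} + (m_{ijl}/m_{jl})·e_{jl}`,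
an element of the free module `F₂` with basis `e_{pq}` indexed by pairs. -/
noncomputable def tauS (K : Type*) [Field K] {n : ℕ} (m : Fin n → Fin 3 → ℕ)
    (i j l : Fin n) : Fin n × Fin n → PR K :=
  Pi.single (i, j) (monom K ((m i ⊔ m j ⊔ m l) - (m i ⊔ m j)))
    - Pi.single (i, l) (monom K ((m i ⊔ m j ⊔ m l) - (m i ⊔ m l)))
    + Pi.single (j, l) (monom K ((m i ⊔ m j ⊔ m l) - (m j ⊔ m l)))

/-- The submodule `Z₃` of `F₂` generated by all `τ_{abc}` with `a < b < c`. -/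
noncomputable def Z3 (K : Type*) [Field K] {n : ℕ} (m : Fin n → Fin 3 → ℕ) :
    Submodule (PR K) (Fin n × Fin n → PR K) :=
  Submodule.span (PR K) {v | ∃ a b c : Fin n, a < b ∧ b < c ∧ v = tauS K m a b c}

theorem monom_add (K : Type*) [Field K] (a b : Fin 3 → ℕ) :
    monom K (a + b) = monom K a * monom K b := by
  simp [monom, pow_add, Finset.prod_mul_distrib]

theorem monom_mem_mxIdeal (K : Type*) [Field K] {a : Fin 3 → ℕ} (ha : a ≠ 0) :
    monom K a ∈ mxIdeal K := by
  obtain ⟨t, ht⟩ := Function.ne_iff.mp ha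
  exact Ideal.mem_of_dvd _
    ((dvd_pow_self (X t) ht).trans (Finset.dvd_prod_of_mem _ (Finset.mem_univ t)))
    (Ideal.subset_span (Set.mem_range_self t))

theorem monom_sub_mul_monom (K : Type*) [Field K] {a b c : Fin 3 → ℕ} (hab : a ≤ b)
    (hbc : b ≤ c) : monom K (c - b) * monom K (b - a) = monom K (c - a) := by
  rw [← monom_add, tsub_add_tsub_cancel hbc hab]

theorem sigmaS_mem_Z2 (K : Type*) [Field K] {n : ℕ} (m : Fin n → Fin 3 → ℕ) (i j : Fin n) :
    sigmaS K m i j ∈ Z2 K m := by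
  have hsingle (p : Fin n) (c : PR K) : syzF1 K m (Pi.single p c) = c * monom K (m p) := by
    simp [syzF1, Pi.single_apply]
  rw [Z2, LinearMap.mem_ker, sigmaS, map_sub, hsingle, hsingle, ← monom_add, ← monom_add,
    tsub_add_cancel_of_le le_sup_right, tsub_add_cancel_of_le le_sup_left, sub_self]

/-- If `m_l` divides `m_{ij}`, then `σ_{ij}` is a monomial combination of `σ_{il}` and
`σ_{jl}`. -/
theorem sigmaS_eq_sub (K : Type*) [Field K] {n : ℕ} (m : Fin n → Fin 3 → ℕ) {i j l : Fin n}
    (hl : m l ≤ m i ⊔ m j) :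
    sigmaS K m i j = monom K ((m i ⊔ m j) - (m i ⊔ m l)) • sigmaS K m i l
      - monom K ((m i ⊔ m j) - (m j ⊔ m l)) • sigmaS K m j l := by
  have hil : m i ⊔ m l ≤ m i ⊔ m j := sup_le le_sup_left hl
  have hjl : m j ⊔ m l ≤ m i ⊔ m j := sup_le le_sup_right hl
  simp only [sigmaS, smul_sub, ← Pi.single_smul, smul_eq_mul,
    monom_sub_mul_monom K le_sup_left hil, monom_sub_mul_monom K le_sup_right hil,
    monom_sub_mul_monom K le_sup_left hjl, monom_sub_mul_monom K le_sup_right hjl]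
  abel

theorem strongDvd.lt {a b : Fin 3 → ℕ} (h : strongDvd a b) {t : Fin 3} (ht : 0 < b t) :
    a t < b t := by
  have := h t ht t
  simp only [Pi.sub_apply, Pi.single_eq_same] at this
  omega

theorem strongDvd.le {a b : Fin 3 → ℕ} (h : strongDvd a b) (hb : b ≠ 0) : a ≤ b := by
  obtain ⟨t, ht⟩ := Function.ne_iff.mp hb
  exact (h t (Nat.pos_of_ne_zero ht)).trans tsub_le_self

/-- If `c` strongly divides `[a, b]` and `b` does not divide `a`, then `[a, c] ≠ [a, b]`. -/
theorem strongDvd.sup_sub_sup_ne_zero {a b c : Fin 3 → ℕ} (h : strongDvd c (a ⊔ b))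
    (hba : ¬ b ≤ a) : (a ⊔ b) - (a ⊔ c) ≠ 0 := by
  obtain ⟨t, ht⟩ : ∃ t, a t < b t := by simpa [Pi.le_def] using hba
  have hsup : (a ⊔ b) t = b t := sup_eq_right.mpr ht.le
  have hlt : c t < b t := hsup ▸ h.lt (hsup ▸ Nat.zero_lt_of_lt ht)
  refine Function.ne_iff.mpr ⟨t, ?_⟩
  rw [Pi.sub_apply, hsup]
  exact (tsub_pos_of_lt (sup_lt_iff.mpr ⟨ht, hlt⟩)).ne'

/-- For a generic monomial ideal, if two distinct minimal generators `m_i, m_j`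
(`i < j`) have the same positive exponent in some variable, then `σ_{ij} ∈ 𝔪Z₂`. -/
theorem stmt9 (K : Type*) [Field K] {n : ℕ} (m : Fin n → Fin 3 → ℕ) (hm : MinGen m)
    (hgen : GenericI m) (i j : Fin n) (hij : i < j)
    (h : ∃ t, 0 < m i t ∧ m i t = m j t) :
    sigmaS K m i j ∈ mxIdeal K • Z2 K m := by
  obtain ⟨l, -, -, hl⟩ := hgen i j hij.ne h
  obtain ⟨t, ht, -⟩ := h
  have hne : m i ⊔ m j ≠ 0 :=
    Function.ne_iff.mpr ⟨t, (ht.trans_le (le_sup_left (b := m j t))).ne'⟩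
  rw [sigmaS_eq_sub K m (hl.le hne)]
  refine sub_mem (Submodule.smul_mem_smul (monom_mem_mxIdeal K ?_) (sigmaS_mem_Z2 K m i l))
    (Submodule.smul_mem_smul (monom_mem_mxIdeal K ?_) (sigmaS_mem_Z2 K m j l))
  · exact hl.sup_sub_sup_ne_zero (hm j i hij.ne')
  · rw [sup_comm (m i)] at hl ⊢
    exact hl.sup_sub_sup_ne_zero (hm i j hij.ne)
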